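/- arXiv:1505.05428 — 3 statements merged into one kernel-verified Lean document; each statement's English description precedes it below -/
import Mathlib

section
/- Let c_m be a nonzero codeword of the simplex code S^α_(q,k) such that at least one coordinate of c_m is a unit of R_q (equivalently, some entry of m is a unit). Then every element r of R_q occurs exactly 2^(2^q·(k−1)) times as a coordinate of c_m, i.e. #{ v ∈ R_q^k : Σ_i m_i v_i = r } = 2^(2^q·(k−1)) for every r ∈ R_q. -/
/-- The ideal of `F₂[u₁,…,u_q]` generated by the squares of all the variables. -/
noncomputable def sqIdeal (q : ℕ) : Ideal (MvPolynomial (Fin q) (ZMod 2)) :=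
  Ideal.span (Set.range fun i : Fin q => MvPolynomial.X i ^ 2)

/-- The ring `R_q = F₂[u₁,…,u_q]/⟨u₁²,…,u_q²⟩`. -/
abbrev Rq (q : ℕ) := MvPolynomial (Fin q) (ZMod 2) ⧸ sqIdeal q

noncomputable def sqInd {q : ℕ} (S : Finset (Fin q)) : Fin q →₀ ℕ :=
  Finsupp.equivFunOnFinite.symm (fun i => if i ∈ S then 1 else 0)

lemma sqInd_apply {q : ℕ} (S : Finset (Fin q)) (i : Fin q) :
    sqInd S i = if i ∈ S then 1 else 0 := rfl

lemma sqInd_injective {q : ℕ} : Function.Injective (sqInd (q := q)) := by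
  intro S T h
  ext i
  have := DFunLike.congr_fun h i
  simp only [sqInd_apply] at this
  by_cases h1 : i ∈ S <;> by_cases h2 : i ∈ T <;> simp_all

lemma mem_sqIdeal {q : ℕ} (p : MvPolynomial (Fin q) (ZMod 2)) :
    p ∈ sqIdeal q ↔ ∀ S : Finset (Fin q), p.coeff (sqInd S) = 0 := by
  have h : sqIdeal q = Ideal.span ((fun s => MvPolynomial.monomial s (1 : ZMod 2)) ''
      (Set.range fun i : Fin q => Finsupp.single i 2)) := by
    rw [sqIdeal, ← Set.range_comp]
    congr 2
    funext i
    simp [MvPolynomial.X_pow_eq_monomial]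
  rw [h, MvPolynomial.mem_ideal_span_monomial_image]
  constructor
  · intro h S
    by_contra hS
    obtain ⟨_, ⟨i, rfl⟩, hi⟩ := h _ (MvPolynomial.mem_support_iff.2 hS)
    have := hi i
    simp only [Finsupp.single_eq_same, sqInd_apply] at this
    split_ifs at this <;> omega
  · intro h x hx
    by_contra hcon
    push Not at hcon
    apply MvPolynomial.mem_support_iff.1 hx
    rw [← h (Finset.univ.filter fun i => x i = 1)]
    congr 1
    ext i
    have h1 := hcon _ ⟨i, rfl⟩
    simp only [Finsupp.single_le_iff] at h1
    simp only [sqInd_apply, Finset.mem_filter, Finset.mem_univ, true_and]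
    split_ifs <;> omega

noncomputable def sqPoly {q : ℕ} (c : Finset (Fin q) → ZMod 2) : MvPolynomial (Fin q) (ZMod 2) :=
  ∑ S, MvPolynomial.monomial (sqInd S) (c S)

lemma coeff_sqPoly {q : ℕ} (c : Finset (Fin q) → ZMod 2) (S : Finset (Fin q)) :
    (sqPoly c).coeff (sqInd S) = c S := by
  classical
  simp [sqPoly, MvPolynomial.coeff_sum, MvPolynomial.coeff_monomial, sqInd_injective.eq_iff]

lemma card_Rq (q : ℕ) : Nat.card (Rq q) = 2 ^ 2 ^ q := by
  have hb : Function.Bijective (fun c : Finset (Fin q) → ZMod 2 =>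
      (Ideal.Quotient.mk (sqIdeal q) (sqPoly c) : Rq q)) := by
    constructor
    · intro c d h
      have h := (mem_sqIdeal _).1 (Ideal.Quotient.eq.1 h)
      funext S
      have := h S
      rw [MvPolynomial.coeff_sub, coeff_sqPoly, coeff_sqPoly] at this
      exact sub_eq_zero.1 this
    · intro x
      obtain ⟨p, rfl⟩ := Ideal.Quotient.mk_surjective x
      refine ⟨fun S => p.coeff (sqInd S), Ideal.Quotient.eq.2 ((mem_sqIdeal _).2 fun S => ?_)⟩
      rw [MvPolynomial.coeff_sub, coeff_sqPoly, sub_self]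
  rw [← Nat.card_congr (Equiv.ofBijective _ hb)]
  simp [Nat.card_eq_fintype_card]

/-- Let `c_m` be a nonzero codeword of the simplex code `S^α_(q,k)` such that at
least one coordinate of `c_m` is a unit of `R_q` (equivalently, some entry of `m` is a unit).
Then every element `r` of `R_q` occurs exactly `2^(2^q·(k−1))` times as a coordinate of `c_m`,
i.e. `#{v ∈ R_q^k : Σ_i m_i v_i = r} = 2^(2^q·(k−1))` for every `r ∈ R_q`. -/
theorem simplex_alpha_coordinate_count (q k : ℕ) (hq : 1 ≤ q) (hk : 1 ≤ k)
    (m : Fin k → Rq q) (hm : ∃ i, IsUnit (m i)) (r : Rq q) :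
    Nat.card {v : Fin k → Rq q // ∑ i, m i * v i = r} = 2 ^ (2 ^ q * (k - 1)) := by
  obtain ⟨i, u, hu⟩ := hm
  obtain ⟨n, rfl⟩ : ∃ n, k = n + 1 := ⟨k - 1, by omega⟩
  have hb : Function.Bijective (fun (v : {v : Fin (n + 1) → Rq q // ∑ i, m i * v i = r})
      (j : Fin n) => v.1 (i.succAbove j)) := by
    constructor
    · rintro ⟨v, hv⟩ ⟨w, hw⟩ h
      have h' : ∀ j, v (i.succAbove j) = w (i.succAbove j) := fun j => congrFun h j
      rw [Fin.sum_univ_succAbove _ i] at hv hw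
      simp only [h'] at hv
      have h2 := add_right_cancel (hv.trans hw.symm)
      rw [← hu] at h2
      have h3 := u.isUnit.mul_left_cancel h2
      apply Subtype.ext
      funext j
      rcases Fin.eq_self_or_eq_succAbove i j with rfl | ⟨j, rfl⟩
      · exact h3
      · exact h' j
    · intro w
      refine ⟨⟨i.insertNth (α := fun _ => Rq q)
        (↑u⁻¹ * (r - ∑ j, m (i.succAbove j) * w j)) w, ?_⟩, ?_⟩
      · rw [Fin.sum_univ_succAbove _ i]
        simp only [Fin.insertNth_apply_same, Fin.insertNth_apply_succAbove]
        rw [← hu, Units.mul_inv_cancel_left, sub_add_cancel]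
      · funext j
        simp
  rw [Nat.card_congr (Equiv.ofBijective _ hb), Nat.card_fun, card_Rq]
  simp [pow_mul]
end

section
/- Every nonzero codeword of the simplex code S^α_(q,k) has Lee weight exactly 2^(2^q·k + q − 1); that is, for every nonzero m ∈ R_q^k, Σ_{v ∈ R_q^k} w_Lee(Σ_i m_i v_i) = 2^(2^q·k + q − 1). Hence S^α_(q,k) has Lee weight distribution A_Lee(0) = 1 and A_Lee(2^(2^q·k + q − 1)) = 2^(2^q·k) − 1. -/
/-- The monomial `u_A = ∏_{i ∈ A} u_i ∈ R_q`. -/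
noncomputable def uA (q : ℕ) (A : Finset (Fin q)) : Rq q :=
  ∏ i ∈ A, Ideal.Quotient.mk (sqIdeal q) (MvPolynomial.X i)

/-- The top monomial `u₁u₂⋯u_q ∈ R_q`. -/
noncomputable def uTop (q : ℕ) : Rq q := uA q Finset.univ

set_option synthInstance.maxHeartbeats 1000000
set_option maxHeartbeats 1000000


lemma uA_mul_X (q : ℕ) (A : Finset (Fin q)) (i : Fin q) :
    uA q A * Ideal.Quotient.mk (sqIdeal q) (MvPolynomial.X i) =
      if i ∈ A then 0 else uA q (insert i A) := by
  have hsq : Ideal.Quotient.mk (sqIdeal q) (MvPolynomial.X i) *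
      Ideal.Quotient.mk (sqIdeal q) (MvPolynomial.X i) = 0 := by
    rw [← map_mul, Ideal.Quotient.eq_zero_iff_mem, ← pow_two]
    exact Ideal.subset_span ⟨i, rfl⟩
  split_ifs with h
  · unfold uA
    rw [← Finset.prod_erase_mul A _ h, mul_assoc, hsq, mul_zero]
  · unfold uA
    rw [Finset.prod_insert h, mul_comm]

lemma uA_mul_disj (q : ℕ) (A B : Finset (Fin q)) (h : Disjoint A B) :
    uA q A * uA q B = uA q (A ∪ B) := by
  unfold uA
  rw [Finset.prod_union h]

lemma uA_mul_not_disj (q : ℕ) (A B : Finset (Fin q)) (h : ¬ Disjoint A B) :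
    uA q A * uA q B = 0 := by
  obtain ⟨i, hA, hB⟩ := Finset.not_disjoint_iff.1 h
  have h1 := uA_mul_X q A i
  rw [if_pos hA] at h1
  have h2 : uA q B = Ideal.Quotient.mk (sqIdeal q) (MvPolynomial.X i) *
      ∏ j ∈ B.erase i, Ideal.Quotient.mk (sqIdeal q) (MvPolynomial.X j) := by
    unfold uA
    exact (Finset.mul_prod_erase B (fun j => Ideal.Quotient.mk (sqIdeal q) (MvPolynomial.X j)) hB).symm
  rw [h2, ← mul_assoc, h1, zero_mul]

lemma uA_span (q : ℕ) (x : Rq q) : x ∈ Submodule.span (ZMod 2) (Set.range (uA q)) := by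
  obtain ⟨p, rfl⟩ := Ideal.Quotient.mk_surjective x
  induction p using MvPolynomial.induction_on with
  | C a =>
    have h : Ideal.Quotient.mk (sqIdeal q) (MvPolynomial.C a) = a • uA q ∅ := by
      have h1 : uA q ∅ = Ideal.Quotient.mk (sqIdeal q) 1 := by simp [uA]
      have h2 : (MvPolynomial.C a : MvPolynomial (Fin q) (ZMod 2)) = a • 1 := by
        rw [MvPolynomial.smul_eq_C_mul, mul_one]
      rw [h1, h2]
      rfl
    rw [h]
    exact Submodule.smul_mem _ _ (Submodule.subset_span ⟨_, rfl⟩)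
  | add p r hp hr =>
    rw [map_add]
    exact Submodule.add_mem _ hp hr
  | mul_X p i hp =>
    rw [map_mul]
    generalize Ideal.Quotient.mk (sqIdeal q) p = y at hp
    induction hp using Submodule.span_induction with
    | mem z hz =>
      obtain ⟨A, rfl⟩ := hz
      rw [uA_mul_X]
      split_ifs
      · exact Submodule.zero_mem _
      · exact Submodule.subset_span ⟨_, rfl⟩
    | zero => rw [zero_mul]; exact Submodule.zero_mem _
    | add a b _ _ ha hb => rw [add_mul]; exact Submodule.add_mem _ ha hb
    | smul c a _ ha => rw [smul_mul_assoc]; exact Submodule.smul_mem _ _ ha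

lemma exists_mul_eq_top (q : ℕ) (x : Rq q) (hx : x ≠ 0) : ∃ w, x * w = uA q Finset.univ := by
  classical
  obtain ⟨c, hc⟩ := (Submodule.mem_span_range_iff_exists_fun (ZMod 2)).1 (uA_span q x)
  have hne : (Finset.univ.filter fun A => c A ≠ 0).Nonempty := by
    by_contra h
    rw [Finset.not_nonempty_iff_eq_empty, Finset.filter_eq_empty_iff] at h
    apply hx
    rw [← hc]
    apply Finset.sum_eq_zero
    intro A hA
    have := h hA
    rw [not_not] at this
    rw [this, zero_smul]
  obtain ⟨A, hA, hmin⟩ := Finset.exists_min_image _ Finset.card hne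
  have hA' : c A = 1 := by
    have h1 := (Finset.mem_filter.1 hA).2
    generalize c A = y at h1
    revert y
    decide
  refine ⟨uA q Aᶜ, ?_⟩
  rw [← hc, Finset.sum_mul, Finset.sum_eq_single A]
  · rw [hA', one_smul, uA_mul_disj _ _ _ disjoint_compl_right, Finset.union_compl]
  · intro B _ hB
    by_cases h0 : c B = 0
    · rw [h0, zero_smul, zero_mul]
    rw [smul_mul_assoc, uA_mul_not_disj, smul_zero]
    intro hd
    have hsub : B ⊆ A := by
      intro i hi
      by_contra hiA
      exact Finset.disjoint_left.1 hd hi (Finset.mem_compl.2 hiA)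
    exact hB (Finset.eq_of_subset_of_card_le hsub (hmin B (by simp [h0])))
  · simp

lemma uA_indep (q : ℕ) (Ψ : Rq q →ₗ[ZMod 2] (Finset (Fin q) → ZMod 2))
    (hΨ : ∀ A B : Finset (Fin q), Ψ (uA q A) B = if B ⊆ A then 1 else 0) :
    LinearIndependent (ZMod 2) (uA q) := by
  classical
  rw [Fintype.linearIndependent_iff]
  intro c hc
  by_contra! hne
  have hne : (Finset.univ.filter fun A => c A ≠ 0).Nonempty := by
    obtain ⟨A, hA⟩ := hne
    exact ⟨A, by simp [hA]⟩
  obtain ⟨A, hA, hmax⟩ := Finset.exists_max_image _ Finset.card hne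
  have h := congrArg (fun y => Ψ y A) hc
  simp only [map_sum, map_smul, map_zero, Finset.sum_apply, Pi.smul_apply, hΨ,
    Pi.zero_apply] at h
  rw [Finset.sum_eq_single A] at h
  · simp at h
    exact (Finset.mem_filter.1 hA).2 h
  · intro B _ hB
    by_cases h0 : c B = 0
    · rw [h0, zero_smul]
    rw [if_neg, smul_zero]
    intro hsub
    exact hB (Finset.eq_of_subset_of_card_le hsub (hmax B (by simp [h0]))).symm
  · simp

lemma card_Rq_s14 (q : ℕ) [Fintype (Rq q)] (Ψ : Rq q →ₗ[ZMod 2] (Finset (Fin q) → ZMod 2))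
    (hΨ : ∀ A B : Finset (Fin q), Ψ (uA q A) B = if B ⊆ A then 1 else 0) :
    Fintype.card (Rq q) = 2 ^ 2 ^ q := by
  have b := Module.Basis.mk (uA_indep q Ψ hΨ) (fun x _ => uA_span q x)
  rw [Module.card_fintype b]
  simp

lemma half_card {V : Type*} [AddCommGroup V] [Fintype V] (f : V →+ ZMod 2) (v₀ : V)
    (h : f v₀ = 1) : 2 * (Finset.univ.filter fun v => f v ≠ 0).card = Fintype.card V := by
  classical
  have h1 := Finset.card_filter_add_card_filter_not (s := (Finset.univ : Finset V))
    (fun v => f v ≠ 0)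
  have h2 : (Finset.univ.filter fun v => f v ≠ 0).card =
      (Finset.univ.filter fun v => ¬ f v ≠ 0).card := by
    have key : ∀ y : ZMod 2, (y ≠ 0 ↔ ¬ (y + 1 ≠ 0)) := by decide
    apply Finset.card_equiv (Equiv.addRight v₀)
    intro v
    simp only [Finset.mem_filter, Finset.mem_univ, true_and, Equiv.coe_addRight, map_add, h]
    exact key _
  rw [Finset.card_univ] at h1
  omega

lemma weight_eq (q k : ℕ) (hq : 1 ≤ q) [Fintype (Rq q)]
    (Ψ : Rq q →ₗ[ZMod 2] (Finset (Fin q) → ZMod 2))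
    (hΨ : ∀ A B : Finset (Fin q), Ψ (uA q A) B = if B ⊆ A then 1 else 0)
    (m : Fin k → Rq q) (hm : m ≠ 0) :
    ∑ v : Fin k → Rq q, hammingNorm (Ψ (∑ i, m i * v i)) = 2 ^ (2 ^ q * k + q - 1) := by
  classical
  obtain ⟨j, hj⟩ := Function.ne_iff.1 hm
  obtain ⟨w, hw⟩ := exists_mul_eq_top q (m j) hj
  have hB : ∀ B : Finset (Fin q), 2 * (Finset.univ.filter fun v : Fin k → Rq q =>
      Ψ (∑ i, m i * v i) B ≠ 0).card = 2 ^ (2 ^ q * k) := by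
    intro B
    let f : (Fin k → Rq q) →+ ZMod 2 :=
      { toFun := fun v => Ψ (∑ i, m i * v i) B
        map_zero' := by simp
        map_add' := by
          intro v v'
          simp [mul_add, Finset.sum_add_distrib] }
    have hf := half_card f (Pi.single j w) (by
      change Ψ (∑ i, m i * (Pi.single j w : Fin k → Rq q) i) B = 1
      rw [Finset.sum_eq_single j]
      · rw [Pi.single_eq_same, hw, hΨ, if_pos (Finset.subset_univ _)]
      · intro i _ hi
        rw [Pi.single_eq_of_ne hi, mul_zero]
      · simp)
    rw [Fintype.card_fun, card_Rq_s14 q Ψ hΨ, Fintype.card_fin, ← pow_mul] at hf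
    exact hf
  have hsum : ∑ v : Fin k → Rq q, hammingNorm (Ψ (∑ i, m i * v i)) =
      ∑ B : Finset (Fin q), (Finset.univ.filter fun v : Fin k → Rq q =>
      Ψ (∑ i, m i * v i) B ≠ 0).card := by
    simp only [hammingNorm, Finset.card_filter]
    exact Finset.sum_comm
  have h2 : 2 * ∑ v : Fin k → Rq q, hammingNorm (Ψ (∑ i, m i * v i)) =
      2 * 2 ^ (2 ^ q * k + q - 1) := by
    rw [hsum, Finset.mul_sum, Finset.sum_congr rfl (fun B _ => hB B), Finset.sum_const,
      Finset.card_univ, Fintype.card_finset, Fintype.card_fin, smul_eq_mul, ← pow_succ',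
      ← pow_add]
    congr 1
    omega
  omega

/-- Every nonzero codeword of the simplex code `S^α_(q,k)` has Lee weight exactly
`2^(2^q·k + q − 1)`: for every nonzero `m ∈ R_q^k`,
`Σ_{v ∈ R_q^k} w_Lee(Σ_i m_i v_i) = 2^(2^q·k + q − 1)`.  Hence `S^α_(q,k)` has Lee weight
distribution `A_Lee(0) = 1` and `A_Lee(2^(2^q·k + q − 1)) = 2^(2^q·k) − 1`.  The Gray map `Ψ`
is specified uniquely by `hΨ`, and `w_Lee = hammingNorm ∘ Ψ`. -/
theorem simplex_alpha_lee_weight_distribution (q k : ℕ) (hq : 1 ≤ q) (hk : 1 ≤ k)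
    [Fintype (Rq q)]
    (Ψ : Rq q →ₗ[ZMod 2] (Finset (Fin q) → ZMod 2))
    (hΨ : ∀ A B : Finset (Fin q), Ψ (uA q A) B = if B ⊆ A then 1 else 0) :
    (∀ m : Fin k → Rq q, m ≠ 0 →
      ∑ v : Fin k → Rq q, hammingNorm (Ψ (∑ i, m i * v i)) = 2 ^ (2 ^ q * k + q - 1)) ∧
    Nat.card {c : (Fin k → Rq q) → Rq q //
        (∃ m : Fin k → Rq q, c = fun v => ∑ i, m i * v i) ∧
        ∑ v : Fin k → Rq q, hammingNorm (Ψ (c v)) = 0} = 1 ∧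
    Nat.card {c : (Fin k → Rq q) → Rq q //
        (∃ m : Fin k → Rq q, c = fun v => ∑ i, m i * v i) ∧
        ∑ v : Fin k → Rq q, hammingNorm (Ψ (c v)) = 2 ^ (2 ^ q * k + q - 1)} =
      2 ^ (2 ^ q * k) - 1 := by
  have W := weight_eq q k hq Ψ hΨ
  have hpos : 0 < 2 ^ (2 ^ q * k + q - 1) := by positivity
  have hz : ∀ m : Fin k → Rq q, m = 0 →
      ∑ v : Fin k → Rq q, hammingNorm (Ψ (∑ i, m i * v i)) = 0 := by
    rintro m rfl
    simp
  refine ⟨W, ?_, ?_⟩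
  · rw [Nat.card_eq_one_iff_unique]
    refine ⟨⟨?_⟩, ⟨⟨fun v => ∑ i, (0 : Fin k → Rq q) i * v i, ⟨0, rfl⟩, hz 0 rfl⟩⟩⟩
    have key : ∀ m : Fin k → Rq q,
        ∑ v : Fin k → Rq q, hammingNorm (Ψ (∑ i, m i * v i)) = 0 → m = 0 := by
      intro m hm
      by_contra h
      have := W m h
      omega
    rintro ⟨c, ⟨m, rfl⟩, hm⟩ ⟨c', ⟨m', rfl⟩, hm'⟩
    have e1 := key m hm
    have e2 := key m' hm'
    subst e1 e2
    rfl
  · classical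
    have hcard : Nat.card {m : Fin k → Rq q // m ≠ 0} = 2 ^ (2 ^ q * k) - 1 := by
      rw [Nat.card_eq_fintype_card, Fintype.card_subtype_compl, Fintype.card_fun,
        card_Rq_s14 q Ψ hΨ, Fintype.card_fin, ← pow_mul]
      simp
    rw [← hcard]
    symm
    apply Nat.card_congr
    refine Equiv.ofBijective (fun m => ⟨fun v => ∑ i, m.1 i * v i, ⟨m.1, rfl⟩, W m.1 m.2⟩) ⟨?_, ?_⟩
    · rintro ⟨m, hm⟩ ⟨m', hm'⟩ h
      apply Subtype.ext
      have h' := congrArg Subtype.val h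
      funext j
      have h2 := congrFun h' (Pi.single j 1)
      simpa [Pi.single_apply] using h2
    · rintro ⟨c, ⟨m, rfl⟩, hm⟩
      refine ⟨⟨m, ?_⟩, rfl⟩
      intro h
      have := hz m h
      simp only at hm
      omega
end

section
/- The torsion code Tor(S^α_(q,k)) of the simplex code of type α equals the binary code { (b·π(v))_{v ∈ R_q^k} : b ∈ F_2^k }, where π : R_q → F_2 is the reduction modulo the maximal ideal applied coordinatewise and b·π(v) = Σ_i b_i π(v_i) ∈ F_2. This code has exactly 2^k codewords, and every nonzero codeword has Hamming weight exactly 2^(2^q·k − 1). -/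
set_option synthInstance.maxHeartbeats 1000000
set_option maxHeartbeats 1000000


lemma aux_mem (q : ℕ) (p : MvPolynomial (Fin q) (ZMod 2)) :
    p ∈ sqIdeal q ↔ ∀ d ∈ p.support, ∃ i, 2 ≤ d i := by
  have h : sqIdeal q = Ideal.span ((fun s => MvPolynomial.monomial s (1 : ZMod 2)) ''
      (Set.range fun i : Fin q => Finsupp.single i 2)) := by
    unfold sqIdeal
    rw [← Set.range_comp]
    congr 2
    funext i
    simp [MvPolynomial.X_pow_eq_monomial]
  rw [h, MvPolynomial.mem_ideal_span_monomial_image]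
  simp

lemma aux_top_ne (q : ℕ) : uTop q ≠ 0 := by
  unfold uTop uA
  rw [← map_prod, Ne, Ideal.Quotient.eq_zero_iff_mem, aux_mem]
  have h : (∏ i : Fin q, MvPolynomial.X i : MvPolynomial (Fin q) (ZMod 2)) =
      MvPolynomial.monomial (∑ i : Fin q, Finsupp.single i 1) 1 := by
    rw [MvPolynomial.monomial_sum_one]
    rfl
  rw [h]
  intro H
  obtain ⟨i, hi⟩ := H (∑ i : Fin q, Finsupp.single i 1) (by
    rw [MvPolynomial.mem_support_iff, MvPolynomial.coeff_monomial]; simp)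
  rw [Finsupp.finsetSum_apply] at hi
  simp [Finsupp.single_apply] at hi

lemma aux_sq (q : ℕ) (i : Fin q) :
    (Ideal.Quotient.mk (sqIdeal q) (MvPolynomial.X i)) ^ 2 = 0 := by
  rw [← map_pow, Ideal.Quotient.eq_zero_iff_mem]
  exact Ideal.subset_span ⟨i, rfl⟩

lemma aux_top_mul (q : ℕ) (i : Fin q) :
    uTop q * Ideal.Quotient.mk (sqIdeal q) (MvPolynomial.X i) = 0 := by
  unfold uTop uA
  rw [← Finset.mul_prod_erase _ _ (Finset.mem_univ i), mul_comm, ← mul_assoc, ← sq, aux_sq,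
    zero_mul]

lemma aux_pi_alg (q : ℕ) (π : Rq q →+* ZMod 2) (a : ZMod 2) :
    π (algebraMap (ZMod 2) (Rq q) a) = a := by
  have : π.comp (algebraMap (ZMod 2) (Rq q)) = RingHom.id _ := Subsingleton.elim _ _
  exact congrArg (fun f => f a) this

lemma aux_pi (q : ℕ) (π : Rq q →+* ZMod 2) (x : Rq q) :
    uTop q * x = uTop q * algebraMap (ZMod 2) (Rq q) (π x) := by
  obtain ⟨p, rfl⟩ := Ideal.Quotient.mk_surjective x
  induction p using MvPolynomial.induction_on with
  | C a =>
    have : Ideal.Quotient.mk (sqIdeal q) (MvPolynomial.C a) = algebraMap (ZMod 2) (Rq q) a := rfl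
    rw [this, aux_pi_alg]
  | add p r hp hr => simp only [map_add, mul_add, hp, hr]
  | mul_X p i hp =>
    have h0 : π (Ideal.Quotient.mk (sqIdeal q) (MvPolynomial.X i)) = 0 := by
      have := congrArg π (aux_sq q i)
      rw [map_pow, map_zero] at this
      exact pow_eq_zero_iff (two_ne_zero) |>.1 this
    rw [map_mul, map_mul, h0, mul_zero, map_zero, mul_zero, mul_left_comm, aux_top_mul, mul_zero]

lemma aux_top_inj (q : ℕ) {x y : ZMod 2}
    (h : uTop q * algebraMap (ZMod 2) (Rq q) x = uTop q * algebraMap (ZMod 2) (Rq q) y) :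
    x = y := by
  by_contra hne
  have h1 : x - y ≠ 0 := sub_ne_zero.2 hne
  have h2 : uTop q * algebraMap (ZMod 2) (Rq q) (x - y) = 0 := by
    rw [map_sub, mul_sub, h, sub_self]
  apply aux_top_ne q
  calc uTop q = uTop q * algebraMap (ZMod 2) (Rq q) ((x - y) * (x - y)⁻¹) := by
        rw [mul_inv_cancel₀ h1, map_one, mul_one]
    _ = 0 := by rw [map_mul, ← mul_assoc, h2, zero_mul]

/-- The exponent vector of a squarefree monomial. -/
noncomputable def auxE (q : ℕ) (f : Fin q → Fin 2) : Fin q →₀ ℕ :=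
  Finsupp.equivFunOnFinite.symm fun i => (f i : ℕ)

lemma auxE_inj (q : ℕ) : Function.Injective (auxE q) := by
  intro f g h
  funext i
  have := DFunLike.congr_fun h i
  exact Fin.ext this

/-- Coefficients at the squarefree monomials. -/
noncomputable def auxL (q : ℕ) :
    MvPolynomial (Fin q) (ZMod 2) →+ ((Fin q → Fin 2) → ZMod 2) where
  toFun p f := p.coeff (auxE q f)
  map_zero' := by funext f; simp
  map_add' p r := by funext f; simp

lemma auxL_ker (q : ℕ) : (auxL q).ker = (sqIdeal q).toAddSubgroup := by
  ext p
  rw [AddMonoidHom.mem_ker, Submodule.mem_toAddSubgroup, aux_mem]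
  constructor
  · intro h d hd
    by_contra! hc
    have := congrFun h (fun i => ⟨d i, hc i⟩)
    have he : auxE q (fun i => ⟨d i, hc i⟩) = d := by ext i; rfl
    change p.coeff (auxE q (fun i => ⟨d i, hc i⟩)) = 0 at this
    rw [he] at this
    exact MvPolynomial.mem_support_iff.1 hd this
  · intro h
    funext f
    change p.coeff (auxE q f) = 0
    by_contra hc
    obtain ⟨i, hi⟩ := h _ (MvPolynomial.mem_support_iff.2 hc)
    have : (auxE q f) i = (f i : ℕ) := rfl
    omega

lemma auxL_surj (q : ℕ) : Function.Surjective (auxL q) := by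
  classical
  intro g
  refine ⟨∑ f, MvPolynomial.monomial (auxE q f) (g f), ?_⟩
  funext f
  change MvPolynomial.coeff (auxE q f) _ = _
  simp [MvPolynomial.coeff_sum, MvPolynomial.coeff_monomial, (auxE_inj q).eq_iff]

lemma aux_card (q : ℕ) : Nat.card (Rq q) = 2 ^ (2 ^ q) := by
  have e := QuotientAddGroup.quotientKerEquivOfSurjective (auxL q) (auxL_surj q) |>.toEquiv
  rw [auxL_ker] at e
  have h : Nat.card (Rq q) = Nat.card ((Fin q → Fin 2) → ZMod 2) := Nat.card_congr e
  rw [h]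
  simp

/-- The torsion code `Tor(S^α_(q,k))` of the simplex code of type α (those binary
words `c` with `(u₁⋯u_q)·ι(c)` in the simplex code, `ι` being the coordinatewise inclusion
`F₂ → R_q`) equals the binary code `{(b·π(v))_{v ∈ R_q^k} : b ∈ F₂^k}`, where `π : R_q → F₂`
is reduction modulo the maximal ideal (the unique ring homomorphism `R_q → F₂`).  This code
has exactly `2^k` codewords, and every nonzero codeword has Hamming weight exactly
`2^(2^q·k − 1)`. -/
theorem simplex_alpha_torsion_code (q k : ℕ) (hq : 1 ≤ q) (hk : 1 ≤ k) [Fintype (Rq q)]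
    (π : Rq q →+* ZMod 2) :
    {c : (Fin k → Rq q) → ZMod 2 | ∃ m : Fin k → Rq q,
        (fun v : Fin k → Rq q => uTop q * algebraMap (ZMod 2) (Rq q) (c v)) =
          fun v => ∑ i, m i * v i} =
      {c : (Fin k → Rq q) → ZMod 2 | ∃ b : Fin k → ZMod 2,
        c = fun v => ∑ i, b i * π (v i)} ∧
    Nat.card {c : (Fin k → Rq q) → ZMod 2 | ∃ b : Fin k → ZMod 2,
        c = fun v => ∑ i, b i * π (v i)} = 2 ^ k ∧
    (∀ c : (Fin k → Rq q) → ZMod 2,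
      (∃ b : Fin k → ZMod 2, c = fun v => ∑ i, b i * π (v i)) → c ≠ 0 →
      Nat.card {v : Fin k → Rq q // c v ≠ 0} = 2 ^ (2 ^ q * k - 1)) := by
  have hinj : Function.Injective (fun (b : Fin k → ZMod 2) =>
      (fun v : Fin k → Rq q => ∑ i, b i * π (v i))) := by
    intro b b' h
    funext j
    have := congrFun h (Pi.single j 1)
    simpa [Pi.single_apply, apply_ite π] using this
  refine ⟨?_, ?_, ?_⟩
  · ext c
    simp only [Set.mem_ofPred_eq]
    constructor
    · rintro ⟨m, hm⟩
      refine ⟨fun i => c (Pi.single i 1), ?_⟩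
      have hm1 : ∀ i, m i = uTop q * algebraMap (ZMod 2) (Rq q) (c (Pi.single i 1)) := by
        intro j
        have := congrFun hm (Pi.single j 1)
        simp only [Pi.single_apply, mul_ite, mul_one, mul_zero, Finset.sum_ite_eq',
          Finset.mem_univ, if_true] at this
        exact this.symm
      funext v
      apply aux_top_inj q
      rw [congrFun hm v, map_sum, Finset.mul_sum]
      refine Finset.sum_congr rfl fun i _ => ?_
      rw [hm1 i, map_mul, mul_right_comm, aux_pi q π (v i), mul_right_comm, mul_assoc]
    · rintro ⟨b, rfl⟩
      refine ⟨fun i => uTop q * algebraMap (ZMod 2) (Rq q) (b i), ?_⟩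
      funext v
      rw [map_sum, Finset.mul_sum]
      refine Finset.sum_congr rfl fun i _ => ?_
      rw [map_mul, mul_right_comm _ _ (v i), aux_pi q π (v i), mul_right_comm, mul_assoc]
  · have hs : {c : (Fin k → Rq q) → ZMod 2 | ∃ b : Fin k → ZMod 2,
        c = fun v => ∑ i, b i * π (v i)} = Set.range (fun (b : Fin k → ZMod 2) =>
      (fun v : Fin k → Rq q => ∑ i, b i * π (v i))) := by
      ext c
      simp only [Set.mem_ofPred_eq, Set.mem_range, eq_comm]
    rw [hs, Nat.card_range_of_injective hinj]
    simp
  · rintro c ⟨b, hb⟩ hc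
    have hadd : ∀ v w, c (v + w) = c v + c w := by
      intro v w
      simp [hb, mul_add, Finset.sum_add_distrib]
    obtain ⟨w, hw⟩ := Function.ne_iff.1 hc
    have h2 : ∀ x y : ZMod 2, y ≠ 0 → (x ≠ 0 ↔ ¬ (x + y ≠ 0)) := by decide
    have e : {v : Fin k → Rq q // c v ≠ 0} ≃ {v : Fin k → Rq q // ¬ (c v ≠ 0)} :=
      (Equiv.addRight w).subtypeEquiv (fun v => by
        rw [Equiv.coe_addRight, hadd]; exact h2 _ _ hw)
    have hsum : Nat.card {v : Fin k → Rq q // c v ≠ 0} +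
        Nat.card {v : Fin k → Rq q // ¬ (c v ≠ 0)} = 2 ^ (2 ^ q * k) := by
      classical
      rw [← Nat.card_sum, Nat.card_congr (Equiv.sumCompl (fun v : Fin k → Rq q => c v ≠ 0)),
        Nat.card_fun, aux_card, Nat.card_fin, ← pow_mul]
    rw [← Nat.card_congr e] at hsum
    have hpos : 2 ^ q * k ≠ 0 := by positivity
    obtain ⟨n, hn⟩ := Nat.exists_eq_succ_of_ne_zero hpos
    rw [hn, Nat.succ_eq_add_one] at hsum ⊢
    rw [pow_succ] at hsum
    simp only [Nat.add_sub_cancel]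
    omega
end
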